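/- Let ξ be a probability distribution on {0,1,2,…} with mean 1 and ξ(1) < 1, and let T be a ξ-Galton–Watson tree, i.e. P(T = t) = ∏_{u ∈ t} ξ(d_t(u)) for every finite rooted ordered tree t. Then for every finite rooted ordered tree t_0 of height at most k and every k ≥ 1, the limit along n with P(#T = n) > 0 satisfies lim_{n→∞} P(T^[k] = t_0 | #T = n) = (#_k t_0) · P(T^[k] = t_0), where #T is the number of vertices of T, T^[k] is the subtree of vertices of height at most k, and #_k t_0 is the number of vertices of t_0 at height exactly k. (Equivalently, T conditioned on #T = n converges in distribution in the local topology to the size-biased ξ-Galton–Watson tree.) -/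

import Mathlib

open Set Filter MeasureTheory Topology TopologicalSpace
open scoped ENNReal

namespace AvoidPaper

/-- Instances for the codomain `ℕ∞` (one-point compactification of `ℕ`). -/
instance : SecondCountableTopology ℕ∞ := by
  have h : ({s : Set ℕ∞ | ∃ a, s = Set.Ioi a ∨ s = Set.Iio a}).Countable := by
    have hsub : {s : Set ℕ∞ | ∃ a, s = Set.Ioi a ∨ s = Set.Iio a}
        ⊆ Set.range (Set.Ioi : ℕ∞ → Set ℕ∞) ∪ Set.range (Set.Iio : ℕ∞ → Set ℕ∞) := by
      rintro s ⟨a, rfl | rfl⟩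
      · exact Or.inl ⟨a, rfl⟩
      · exact Or.inr ⟨a, rfl⟩
    exact ((Set.countable_range _).union (Set.countable_range _)).mono hsub
  exact SecondCountableTopology.mk' h

instance : OpensMeasurableSpace ℕ∞ := ⟨le_top⟩

/-! ## Ulam–Harris vertices and rooted ordered trees -/

/-- A vertex of the Ulam–Harris tree: a finite list of natural numbers (children indices),
ordered lexicographically (so an ancestor precedes its descendants). -/
abbrev Vertex : Type := List ℕ

/-- A (rooted ordered) tree: contains the root, is closed under ancestors, and is
left-closed among siblings. -/
def IsTree (t : Set Vertex) : Prop :=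
  ([] : Vertex) ∈ t ∧ (∀ u v : Vertex, u ++ v ∈ t → u ∈ t) ∧
    ∀ (u : Vertex) (i j : ℕ), u ++ [i] ∈ t → j ≤ i → u ++ [j] ∈ t

/-- The set of children indices of `u` in `t`. -/
def children (t : Set Vertex) (u : Vertex) : Set ℕ := {i | u ++ [i] ∈ t}

/-- Locally finite tree. -/
def LocFin (t : Set Vertex) : Prop := ∀ u : Vertex, (children t u).Finite

/-- Number of children of `u` in `t`. -/
noncomputable def childCount (t : Set Vertex) (u : Vertex) : ℕ := (children t u).ncard

/-- The degree function `d_t(u)`: number of children, and `-1` if `u ∉ t`. -/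
noncomputable def deg (t : Set Vertex) (u : Vertex) : ℤ :=
  haveI := Classical.dec (u ∈ t)
  if u ∈ t then (childCount t u : ℤ) else -1

/-- `t^[m]`: restriction of `t` to the vertices of height at most `m`. -/
def trunc (t : Set Vertex) (m : ℕ) : Set Vertex := {u ∈ t | u.length ≤ m}

/-- Local convergence of trees: `d_{t_n}(u) → d_t(u)` for every vertex `u`
(equivalently, eventual equality, since degrees are integers). -/
def LocalConv (ts : ℕ → Set Vertex) (t : Set Vertex) : Prop :=
  ∀ u : Vertex, ∀ᶠ n in atTop, deg (ts n) u = deg t u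

/-- A leaf: a vertex of `t` with no children. -/
def IsLeaf (t : Set Vertex) (v : Vertex) : Prop := v ∈ t ∧ ∀ i : ℕ, v ++ [i] ∉ t

def leafSet (t : Set Vertex) : Set Vertex := {v | IsLeaf t v}

/-- The fringe subtree `t_v` of `t` at `v` (as a subset of `t`). -/
def fringe (t : Set Vertex) (v : Vertex) : Set Vertex := {x ∈ t | v <+: x}

/-- Number of vertices of `t` at height exactly `k`. -/
noncomputable def levelCount (t : Set Vertex) (k : ℕ) : ℕ := {u ∈ t | u.length = k}.ncard

/-- An infinite spine of `t`: `η 0` is the root and `η (i+1)` is a child of `η i`. -/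
def IsSpine (t : Set Vertex) (η : ℕ → Vertex) : Prop :=
  η 0 = [] ∧ (∀ i, η i ∈ t) ∧ ∀ i, ∃ c : ℕ, η (i + 1) = η i ++ [c]

/-- `v` lies strictly to the left of the spine `η`. -/
def LeftOfSpine (t : Set Vertex) (η : ℕ → Vertex) (v : Vertex) : Prop :=
  v ∈ t ∧ (∀ i, η i ≠ v) ∧ ∃ j, v < η j

/-- `v` lies strictly to the right of the spine `η`. -/
def RightOfSpine (t : Set Vertex) (η : ℕ → Vertex) (v : Vertex) : Prop :=
  v ∈ t ∧ ∀ j, η j < v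

/-- `η` is the unique infinite spine of `t`, with infinitely many subtrees attached to
the left and to the right of the spine, infinitely many of the left ones having at
least two vertices. -/
def SpineSpec (t : Set Vertex) (η : ℕ → Vertex) : Prop :=
  IsSpine t η ∧ (∀ η', IsSpine t η' → η' = η) ∧
  {u : Vertex | (∃ k c, u = η k ++ [c]) ∧ LeftOfSpine t η u}.Infinite ∧
  {u : Vertex | (∃ k c, u = η k ++ [c]) ∧ RightOfSpine t η u}.Infinite ∧
  {u : Vertex | (∃ k c, u = η k ++ [c]) ∧ LeftOfSpine t η u ∧
      2 ≤ (fringe t u).encard}.Infinite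

/-- `𝔗_f`: finite trees with at least two vertices. -/
def MemTf (t : Set Vertex) : Prop := IsTree t ∧ t.Finite ∧ 2 ≤ t.encard

/-- `𝔗_∞`. -/
def MemTinf (t : Set Vertex) : Prop :=
  IsTree t ∧ LocFin t ∧ t.Infinite ∧ ∃ η : ℕ → Vertex, SpineSpec t η

/-- The leaves of `t` lying to the left of the spine `η`. -/
def leftLeaves (t : Set Vertex) (η : ℕ → Vertex) : Set Vertex :=
  {x | IsLeaf t x ∧ LeftOfSpine t η x}

/-- `v` is the enumeration `(v_{t,i})` of (an initial part of) `t` in increasing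
lexicographic order: `v i ∈ t` and the vertices of `t` smaller than `v i` are
exactly `v 0, …, v (i-1)`. -/
def IsLexEnum (t : Set Vertex) (v : ℕ → Vertex) : Prop :=
  ∀ i : ℕ, (i : ℕ∞) < t.encard →
    v i ∈ t ∧ {x ∈ t | x < v i} = v '' {j | j < i}

/-- `w` is the enumeration `(w_{t,i})` of (a final part of) `t` in decreasing
lexicographic order, starting from the lexicographically largest vertex. -/
def IsLexCoEnum (t : Set Vertex) (w : ℕ → Vertex) : Prop :=
  ∀ i : ℕ, (i : ℕ∞) < t.encard →
    w i ∈ t ∧ {x ∈ t | w i < x} = w '' {j | j < i}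

/-- `l` enumerates the set `A` in increasing lexicographic order. -/
def IsEnumOf (A : Set Vertex) (l : ℕ → Vertex) : Prop :=
  ∀ i : ℕ, (i : ℕ∞) < A.encard →
    l i ∈ A ∧ {x ∈ A | x < l i} = l '' {j | j < i}

/-- `s_i`: the number of vertices of `t` lexicographically smaller than the `i`-th leaf
(0-indexed: `l 0` is the paper's `l_1`). -/
noncomputable def sVal (t : Set Vertex) (l : ℕ → Vertex) (i : ℕ) : ℕ :=
  {x ∈ t | x < l i}.ncard

/-- `p_i`: the height of the `i`-th leaf. -/
def pVal (l : ℕ → Vertex) (i : ℕ) : ℕ := (l i).length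

/-! ## The maps Φ^σ -/

/-- `Φ^{231}` as an element of `F(ℕ, ℕ*)` (value `i` outside the range of indices). -/
noncomputable def phi231 (t : Set Vertex) (v : ℕ → Vertex) : ℕ → ℕ∞ := fun i =>
  if 1 ≤ i ∧ (i : ℕ∞) < t.encard then
    ((i : ℕ∞) + (fringe t (v i)).encard) - ((v i).length : ℕ∞)
  else (i : ℕ∞)

noncomputable def phi213 (t : Set Vertex) (v : ℕ → Vertex) : ℕ → ℕ∞ := fun i =>
  if 1 ≤ i ∧ (i : ℕ∞) < t.encard then
    ((t \ fringe t (v i)).encard + ((v i).length : ℕ∞)) - (i : ℕ∞)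
  else (i : ℕ∞)

noncomputable def phi312 (t : Set Vertex) (w : ℕ → Vertex) : ℕ → ℕ∞ := fun i =>
  if 1 ≤ i ∧ (i : ℕ∞) < t.encard then
    ((i : ℕ∞) + ((w (i - 1)).length : ℕ∞)) - (fringe t (w (i - 1))).encard
  else (i : ℕ∞)

noncomputable def phi132 (t : Set Vertex) (w : ℕ → Vertex) : ℕ → ℕ∞ := fun i =>
  if 1 ≤ i ∧ (i : ℕ∞) < t.encard then
    ((t.encard + (fringe t (w (i - 1))).encard) - (i : ℕ∞)) - ((w (i - 1)).length : ℕ∞)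
  else (i : ℕ∞)

/-- `B = {s_i - p_i + 1 : i}` (with `i` ranging over indices `< L` of leaves). -/
def Bset (S P : ℕ → ℕ) (L : ℕ∞) : Set ℕ :=
  {b | ∃ i : ℕ, (i : ℕ∞) < L ∧ S i - P i + 1 = b}

/-- `A = {s_i : i}`. -/
def Aset (S : ℕ → ℕ) (L : ℕ∞) : Set ℕ := {a | ∃ i : ℕ, (i : ℕ∞) < L ∧ S i = a}

/-- The number of elements of `C` in `{1, …, j}`. -/
noncomputable def rankIn (C : Set ℕ) (j : ℕ) : ℕ := (C ∩ Set.Icc 1 j).ncard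

/-- The `a`-th smallest positive element of `C`. -/
noncomputable def nthOf (C : Set ℕ) (a : ℕ) : ℕ :=
  sInf {m : ℕ | a ≤ (C ∩ Set.Icc 1 m).ncard}

open Classical in
/-- `Φ^{321}` built from the data `s, p` (and the number `L` of leaves):
`s_i - p_i + 1 ↦ s_i`, extended by the unique increasing bijection between the
complements (and by the identity outside `[1, n]` in the finite case). -/
noncomputable def phi321Fun (S P : ℕ → ℕ) (L : ℕ∞) : ℕ → ℕ∞ := fun j =>
  if h : j ∈ Bset S P L then (S h.choose : ℕ∞)
  else (nthOf (Aset S L)ᶜ (rankIn (Bset S P L)ᶜ j) : ℕ∞)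

/-- `Φ^{123} = |t| + 1 - Φ^{321}` as an element of `F(ℕ, ℕ*)`. -/
noncomputable def phi123Fun (tc : ℕ∞) (f : ℕ → ℕ∞) : ℕ → ℕ∞ := fun j =>
  if 1 ≤ j ∧ (j : ℕ∞) < tc then (tc + 1) - f j else (j : ℕ∞)

/-! ## Patterns and pattern avoidance -/

def p123 : Equiv.Perm (Fin 3) := Equiv.refl _
noncomputable def p321 : Equiv.Perm (Fin 3) := Equiv.ofBijective ![2, 1, 0] (by decide)
noncomputable def p231 : Equiv.Perm (Fin 3) := Equiv.ofBijective ![1, 2, 0] (by decide)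
noncomputable def p213 : Equiv.Perm (Fin 3) := Equiv.ofBijective ![1, 0, 2] (by decide)
noncomputable def p312 : Equiv.Perm (Fin 3) := Equiv.ofBijective ![2, 0, 1] (by decide)
noncomputable def p132 : Equiv.Perm (Fin 3) := Equiv.ofBijective ![0, 2, 1] (by decide)

/-- `π` contains the length-3 pattern `σ`. -/
def ContainsPat {n : ℕ} (π : Equiv.Perm (Fin n)) (σ : Equiv.Perm (Fin 3)) : Prop :=
  ∃ f : Fin 3 → Fin n, StrictMono f ∧ ∀ j k : Fin 3, σ j < σ k ↔ π (f j) < π (f k)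

/-- `π` avoids the length-3 pattern `σ`. -/
def AvoidsPat {n : ℕ} (π : Equiv.Perm (Fin n)) (σ : Equiv.Perm (Fin 3)) : Prop :=
  ¬ ContainsPat π σ

/-- Trees with `n+1` vertices. -/
def TreeN (n : ℕ) : Type := {t : Set Vertex // IsTree t ∧ t.encard = (n : ℕ∞) + 1}

/-- Embedding of a permutation of `[n]` into `F(ℕ, ℕ*)` by `π(k) = k` for `k > n`
(permutations are `1`-indexed: position `k ∈ [1, n]` corresponds to `k - 1 : Fin n`). -/
noncomputable def embedPerm {n : ℕ} (π : Equiv.Perm (Fin n)) : ℕ → ℕ∞ := fun k =>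
  if h : 1 ≤ k ∧ k ≤ n then (((π ⟨k - 1, by omega⟩ : Fin n) : ℕ) + 1 : ℕ) else (k : ℕ∞)

/-- The (finite) set of permutations of `[n]` avoiding `σ`. -/
noncomputable def avoidFinset (σ : Equiv.Perm (Fin 3)) (n : ℕ) : Finset (Equiv.Perm (Fin n)) :=
  Set.Finite.toFinset (Set.toFinite {π : Equiv.Perm (Fin n) | AvoidsPat π σ})

/-- The law of a uniformly random `σ`-avoiding permutation of `[n]`,
as a measure on `F(ℕ, ℕ*)`. -/
noncomputable def uniformAvoidLaw (σ : Equiv.Perm (Fin 3)) (n : ℕ) : Measure (ℕ → ℕ∞) :=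
  ((avoidFinset σ n).card : ℝ≥0∞)⁻¹ • ∑ π ∈ avoidFinset σ n, Measure.dirac (embedPerm π)


open Classical in
/-- `Φ^σ` for an arbitrary pattern `σ ∈ S_3`, given a tree together with its increasing
vertex enumeration `v`, its decreasing vertex enumeration `w`, and the increasing
enumeration `l` of the relevant set `Lset` of leaves. -/
noncomputable def PhiOf (σ : Equiv.Perm (Fin 3)) (t : Set Vertex)
    (v w l : ℕ → Vertex) (Lset : Set Vertex) : ℕ → ℕ∞ :=
  if σ = p231 then phi231 t v
  else if σ = p213 then phi213 t v
  else if σ = p312 then phi312 t w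
  else if σ = p132 then phi132 t w
  else if σ = p321 then phi321Fun (sVal t l) (pVal l) Lset.encard
  else phi123Fun t.encard (phi321Fun (sVal t l) (pVal l) Lset.encard)

open Classical in
noncomputable def canonSpine (t : Set Vertex) : ℕ → Vertex :=
  if h : ∃ η : ℕ → Vertex, IsSpine t η then h.choose else fun _ => []

open Classical in
noncomputable def canonV (t : Set Vertex) : ℕ → Vertex :=
  if h : ∃ v : ℕ → Vertex, IsLexEnum t v then h.choose else fun _ => []

open Classical in
noncomputable def canonW (t : Set Vertex) : ℕ → Vertex :=
  if h : ∃ w : ℕ → Vertex, IsLexCoEnum t w then h.choose else fun _ => []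

open Classical in
noncomputable def canonL (t : Set Vertex) : ℕ → Vertex :=
  if h : ∃ l : ℕ → Vertex, IsEnumOf (leftLeaves t (canonSpine t)) l then h.choose
  else fun _ => []

/-- `Φ^σ_t` for an infinite tree `t ∈ 𝔗_∞`, using the canonical (unique) spine and
enumerations. -/
noncomputable def PhiCanon (σ : Equiv.Perm (Fin 3)) (t : Set Vertex) : ℕ → ℕ∞ :=
  PhiOf σ t (canonV t) (canonW t) (canonL t) (leftLeaves t (canonSpine t))

/-- σ-algebra on the space of trees: all sets are measurable. -/
instance : MeasurableSpace (Set Vertex) := ⊤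

/-- `μ` is the law of a Galton–Watson tree with offspring distribution `ξ`:
a probability measure, supported on trees, giving each finite tree `t` the
probability `∏_{u ∈ t} ξ(d_t(u))`. -/
def IsGW (ξ : ℕ → ℝ≥0∞) (μ : Measure (Set Vertex)) : Prop :=
  IsProbabilityMeasure μ ∧ μ {t | IsTree t} = 1 ∧
    ∀ t : Set Vertex, IsTree t → ∀ ht : t.Finite,
      μ {t} = ∏ u ∈ ht.toFinset, ξ (childCount t u)

/-- `π` is the permutation `Φ^{321}_t` of `[n]` associated to a finite tree `t` with
`n+1` vertices: for every leaf `v` with `s = #{x ∈ t : x < v}` and `p = |v|`, position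
`s - p + 1` is mapped to `s` (in 0-indexed form: position `s - p` to value `s - 1`),
and `π` is increasing on the remaining positions. -/
def Is321Image (n : ℕ) (t : Set Vertex) (π : Equiv.Perm (Fin n)) : Prop :=
  (∀ v : Vertex, IsLeaf t v →
    ∃ hb : {x ∈ t | x < v}.ncard - v.length < n,
      ((π ⟨{x ∈ t | x < v}.ncard - v.length, hb⟩ : Fin n) : ℕ)
        = {x ∈ t | x < v}.ncard - 1) ∧
  ∀ a b : Fin n, a < b →
    (∀ v : Vertex, IsLeaf t v → {x ∈ t | x < v}.ncard - v.length ≠ (a : ℕ)) →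
    (∀ v : Vertex, IsLeaf t v → {x ∈ t | x < v}.ncard - v.length ≠ (b : ℕ)) →
    π a < π b

/-- `π` is the permutation `Φ^{123}_t = (n+1) - Φ^{321}_t` of `[n]`. -/
def Is123Image (n : ℕ) (t : Set Vertex) (π : Equiv.Perm (Fin n)) : Prop :=
  ∃ π' : Equiv.Perm (Fin n), Is321Image n t π' ∧ ∀ i : Fin n, π i = Fin.rev (π' i)


/-! ## Evaluation of power series with coefficients in `ℝ≥0∞` -/

/-- The value at `x` of a power series with coefficients in `ℝ≥0∞`. -/
noncomputable def evalAt (x : ℝ≥0∞) (φ : PowerSeries ℝ≥0∞) : ℝ≥0∞ :=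
  ∑' n, PowerSeries.coeff n φ * x ^ n

theorem evalAt_one (x : ℝ≥0∞) : evalAt x 1 = 1 := by
  rw [evalAt, tsum_eq_single 0]
  · simp
  · intro n hn
    simp [PowerSeries.coeff_one, hn]

theorem evalAt_mul (x : ℝ≥0∞) (φ ψ : PowerSeries ℝ≥0∞) :
    evalAt x (φ * ψ) = evalAt x φ * evalAt x ψ := by
  unfold evalAt
  rw [← ENNReal.tsum_mul_right]
  simp_rw [← ENNReal.tsum_mul_left]
  rw [← ENNReal.tsum_prod (f := fun i j =>
    PowerSeries.coeff i φ * x ^ i * (PowerSeries.coeff j ψ * x ^ j)),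
    ← Finset.HasAntidiagonal.sigmaAntidiagonalEquivProd.tsum_eq, ENNReal.tsum_sigma']
  refine tsum_congr fun n => ?_
  rw [PowerSeries.coeff_mul, Finset.sum_mul, tsum_fintype,
    ← Finset.sum_coe_sort (Finset.HasAntidiagonal.antidiagonal n)]
  refine Finset.sum_congr rfl fun p _ => ?_
  have hp : p.1.1 + p.1.2 = n := Finset.HasAntidiagonal.mem_antidiagonal.1 p.2
  simp only [Finset.HasAntidiagonal.sigmaAntidiagonalEquivProd_apply]
  have hx : x ^ n = x ^ p.1.1 * x ^ p.1.2 := by rw [← pow_add, hp]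
  rw [hx]
  ring

theorem evalAt_pow (x : ℝ≥0∞) (φ : PowerSeries ℝ≥0∞) (m : ℕ) :
    evalAt x (φ ^ m) = evalAt x φ ^ m := by
  induction m with
  | zero => simp [evalAt_one]
  | succ m ih => rw [pow_succ, evalAt_mul, ih, pow_succ]

theorem evalAt_X (x : ℝ≥0∞) : evalAt x PowerSeries.X = x := by
  rw [evalAt, tsum_eq_single 1]
  · simp
  · intro n hn
    simp [PowerSeries.coeff_X, hn]

theorem evalAt_C (x c : ℝ≥0∞) : evalAt x (PowerSeries.C c) = c := by
  rw [evalAt, tsum_eq_single 0]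
  · simp
  · intro n hn
    simp [PowerSeries.coeff_C, hn]

theorem coeff_le_evalAt_one (φ : PowerSeries ℝ≥0∞) (n : ℕ) :
    PowerSeries.coeff n φ ≤ evalAt 1 φ := by
  simpa [evalAt] using ENNReal.le_tsum (f := fun n => PowerSeries.coeff n φ * 1 ^ n) n

/-! ## The functional equation `A = X F(A)` and Lagrange inversion -/

/-- `A = X F(A)`, written coefficientwise. -/
def SolvesTreeEquation (ξ : ℕ → ℝ≥0∞) (A : PowerSeries ℝ≥0∞) : Prop :=
  PowerSeries.coeff 0 A = 0 ∧
    ∀ n, PowerSeries.coeff (n + 1) A = ∑' i, ξ i * PowerSeries.coeff n (A ^ i)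

theorem SolvesTreeEquation.coeff_pow_eq_zero {ξ : ℕ → ℝ≥0∞} {A : PowerSeries ℝ≥0∞}
    (hA : SolvesTreeEquation ξ A) {n m : ℕ} (h : n < m) : PowerSeries.coeff n (A ^ m) = 0 := by
  have h1 : PowerSeries.X ∣ A := by
    rw [PowerSeries.X_dvd_iff, ← PowerSeries.coeff_zero_eq_constantCoeff_apply]
    exact hA.1
  exact PowerSeries.X_pow_dvd_iff.1 (pow_dvd_pow_of_dvd h1 m) n h

theorem SolvesTreeEquation.evalAt_eq {ξ : ℕ → ℝ≥0∞} {A : PowerSeries ℝ≥0∞}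
    (hA : SolvesTreeEquation ξ A) (x : ℝ≥0∞) :
    evalAt x A = x * ∑' i, ξ i * evalAt x A ^ i := by
  conv_lhs => rw [evalAt, tsum_eq_zero_add' ENNReal.summable]
  simp only [hA.1, hA.2, zero_mul, zero_add, ← evalAt_pow]
  simp only [evalAt, ← ENNReal.tsum_mul_left, ← ENNReal.tsum_mul_right]
  rw [ENNReal.tsum_comm]
  refine tsum_congr fun i => tsum_congr fun n => ?_
  ring

theorem SolvesTreeEquation.coeff_succ_pow {ξ : ℕ → ℝ≥0∞} {A : PowerSeries ℝ≥0∞}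
    (hA : SolvesTreeEquation ξ A) (n m : ℕ) :
    PowerSeries.coeff (n + 1) (A ^ (m + 1)) =
      ∑' i, ξ i * PowerSeries.coeff n (A ^ (m + i)) := by
  rw [pow_succ', PowerSeries.coeff_mul, Finset.Nat.sum_antidiagonal_succ]
  simp only [hA.1, zero_mul, zero_add, hA.2, ← ENNReal.tsum_mul_right]
  rw [← Summable.tsum_finsetSum fun _ _ => ENNReal.summable]
  refine tsum_congr fun i => ?_
  rw [add_comm m i, pow_add, PowerSeries.coeff_mul, Finset.mul_sum]
  refine Finset.sum_congr rfl fun p _ => ?_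
  ring

theorem succ_mul_sum_antidiagonal_eq {R : Type*} [CommSemiring R] (ξ : ℕ → R) (n j : ℕ) :
    (n + 1 : R) * ∑ p ∈ Finset.HasAntidiagonal.antidiagonal j,
        (p.1 : R) * ξ p.1 * PowerSeries.coeff p.2 (PowerSeries.mk ξ ^ n) =
      j * PowerSeries.coeff j (PowerSeries.mk ξ ^ (n + 1)) := by
  rcases j with _ | j
  · simp
  have h := congrArg (PowerSeries.coeff j)
    (PowerSeries.derivative_pow (PowerSeries.mk ξ) (n + 1))
  rw [PowerSeries.coeff_derivative, Nat.add_sub_cancel, mul_assoc, mul_comm (_ ^ n),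
    ← map_natCast (PowerSeries.C (R := R)), PowerSeries.coeff_C_mul, PowerSeries.coeff_mul] at h
  rw [Finset.Nat.sum_antidiagonal_succ, mul_comm ((j + 1 : ℕ) : R)]
  push_cast at h ⊢
  rw [h]
  simp [PowerSeries.coeff_derivative, mul_comm]

theorem SolvesTreeEquation.lagrange_inversion {ξ : ℕ → ℝ≥0∞} {A : PowerSeries ℝ≥0∞}
    (hA : SolvesTreeEquation ξ A) (n m j : ℕ) (h : j + m = n) :
    (n : ℝ≥0∞) * PowerSeries.coeff n (A ^ m) =
      m * PowerSeries.coeff j (PowerSeries.mk ξ ^ n) := by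
  induction n generalizing m j with
  | zero =>
    obtain rfl : m = 0 := by omega
    simp
  | succ n ih =>
    rcases m with _ | m
    · simp [PowerSeries.coeff_one]
    have hS : ∀ i, j < i → ξ i * PowerSeries.coeff n (A ^ (m + i)) = 0 := fun i hi => by
      rw [hA.coeff_pow_eq_zero (by omega), mul_zero]
    rw [hA.coeff_succ_pow, tsum_eq_sum (s := Finset.range (j + 1))
      (fun i hi => hS i (by simpa using hi))]
    rcases Nat.eq_zero_or_pos n with rfl | hn
    · obtain rfl : j = 0 := by omega
      obtain rfl : m = 0 := by omega
      simp
    have key : (n : ℝ≥0∞) * ∑ i ∈ Finset.range (j + 1), ξ i * PowerSeries.coeff n (A ^ (m + i)) =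
        m * PowerSeries.coeff j (PowerSeries.mk ξ ^ (n + 1)) +
          ∑ p ∈ Finset.HasAntidiagonal.antidiagonal j,
            (p.1 : ℝ≥0∞) * ξ p.1 * PowerSeries.coeff p.2 (PowerSeries.mk ξ ^ n) := by
      rw [pow_succ', PowerSeries.coeff_mul, Finset.mul_sum, Finset.mul_sum,
        ← Finset.sum_add_distrib, Finset.Nat.sum_antidiagonal_eq_sum_range_succ_mk]
      refine Finset.sum_congr rfl fun i hi => ?_
      have hi : i ≤ j := by simpa [Nat.lt_succ_iff] using hi
      have := ih (m + i) (j - i) (by omega)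
      rw [mul_left_comm, this, PowerSeries.coeff_mk]
      push_cast
      ring
    have hn0 : (n : ℝ≥0∞) ≠ 0 := by exact_mod_cast hn.ne'
    refine (ENNReal.mul_right_inj hn0 (ENNReal.natCast_ne_top n)).1 ?_
    rw [mul_left_comm, key, mul_add]
    push_cast
    rw [succ_mul_sum_antidiagonal_eq]
    have hj : (n : ℝ≥0∞) = j + m := by exact_mod_cast (by omega : n = j + m)
    rw [hj]
    ring

/-! ## Critical offspring distributions -/

/-- A probability distribution on `ℕ` with mean `1` that is not concentrated at `1`. -/
structure IsCritical (ξ : ℕ → ℝ≥0∞) : Prop where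
  tsum_eq : ∑' i, ξ i = 1
  mean_eq : ∑' i : ℕ, (i : ℝ≥0∞) * ξ i = 1
  lt_one : ξ 1 < 1

theorem one_add_mul_le_pow_add {y : ℝ≥0∞} (hy : y ≠ ⊤) (i : ℕ) :
    1 + i * y ≤ y ^ i + i := by
  lift y to NNReal using hy
  have h := one_add_mul_le_pow (a := (y : ℝ) - 1) (by linarith [y.2]) i
  have h2 : (1 : ℝ) + i * y ≤ (y : ℝ) ^ i + i := by
    have : (1 : ℝ) + ((y : ℝ) - 1) = y := by ring
    rw [this] at h
    linarith
  have h3 : 1 + (i : NNReal) * y ≤ y ^ i + i := by exact_mod_cast h2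
  exact_mod_cast h3

theorem one_add_mul_lt_pow_add {y : ℝ≥0∞} (hy : y < 1) {i : ℕ} (hi : 2 ≤ i) :
    1 + i * y < y ^ i + i := by
  lift y to NNReal using hy.ne_top
  have hy1 : (y : ℝ) < 1 := by exact_mod_cast hy
  have h2 : (1 : ℝ) + i * y < (y : ℝ) ^ i + i := by
    obtain ⟨l, rfl⟩ : ∃ l, i = l + 2 := ⟨i - 2, by omega⟩
    have h := one_add_mul_le_pow (a := (y : ℝ) - 1) (by linarith [y.2]) l
    rw [show (1 : ℝ) + ((y : ℝ) - 1) = y by ring] at h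
    have hy0 : (0 : ℝ) ≤ y := y.2
    have h4 := mul_le_mul_of_nonneg_right h (sq_nonneg (y : ℝ))
    rw [← pow_add] at h4
    push_cast
    have hl : (0 : ℝ) ≤ l := Nat.cast_nonneg l
    nlinarith [mul_nonneg hl (mul_nonneg (by linarith : (0 : ℝ) ≤ 1 + y) (sq_nonneg ((y : ℝ) - 1))),
      mul_pos (sub_pos.2 hy1) (sub_pos.2 hy1)]
  have h3 : 1 + (i : NNReal) * y < y ^ i + i := by exact_mod_cast h2
  exact_mod_cast h3

namespace IsCritical

variable {ξ : ℕ → ℝ≥0∞}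

theorem le_one (h : IsCritical ξ) (i : ℕ) : ξ i ≤ 1 := h.tsum_eq ▸ ENNReal.le_tsum i

theorem ne_top (h : IsCritical ξ) (i : ℕ) : ξ i ≠ ⊤ := ((h.le_one i).trans_lt (by simp)).ne

theorem exists_two_le (h : IsCritical ξ) : ∃ i, 2 ≤ i ∧ ξ i ≠ 0 := by
  by_contra! hc
  have h1 : ∑' i : ℕ, (i : ℝ≥0∞) * ξ i = ξ 1 := by
    rw [tsum_eq_single 1]
    · simp
    · intro i hi
      rcases i with _ | i
      · simp
      · rw [hc (i + 1) (by omega), mul_zero]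
  exact h.lt_one.ne (h1 ▸ h.mean_eq)

theorem zero_ne_zero (h : IsCritical ξ) : ξ 0 ≠ 0 := by
  intro h0
  obtain ⟨i, hi, hξ⟩ := h.exists_two_le
  have hlt : ∑' i, ξ i < ∑' i : ℕ, (i : ℝ≥0∞) * ξ i := by
    refine ENNReal.tsum_lt_tsum (i := i) (by simp [h.tsum_eq]) (fun j => ?_) ?_
    · rcases j with _ | j
      · simp [h0]
      · exact le_mul_of_one_le_left' (by exact_mod_cast Nat.succ_pos j)
    · calc ξ i = 1 * ξ i := (one_mul _).symm
        _ < i * ξ i := by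
          refine (ENNReal.mul_lt_mul_iff_left hξ (h.ne_top i)).2 ?_
          exact_mod_cast hi
  rw [h.tsum_eq, h.mean_eq] at hlt
  exact lt_irrefl _ hlt

theorem tsum_mul_one_add_mul (h : IsCritical ξ) (y : ℝ≥0∞) :
    ∑' i : ℕ, ξ i * (1 + i * y) = 1 + y := by
  have : ∀ i : ℕ, ξ i * (1 + i * y) = ξ i + i * ξ i * y := fun i => by ring
  simp_rw [this]
  rw [ENNReal.tsum_add, ENNReal.tsum_mul_right, h.tsum_eq, h.mean_eq, one_mul]

theorem tsum_mul_pow_add (h : IsCritical ξ) (y : ℝ≥0∞) :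
    ∑' i : ℕ, ξ i * (y ^ i + i) = (∑' i, ξ i * y ^ i) + 1 := by
  have : ∀ i : ℕ, ξ i * (y ^ i + i) = ξ i * y ^ i + i * ξ i := fun i => by ring
  simp_rw [this]
  rw [ENNReal.tsum_add, h.mean_eq]

theorem le_tsum_mul_pow (h : IsCritical ξ) {y : ℝ≥0∞} (hy : y ≠ ⊤) :
    y ≤ ∑' i, ξ i * y ^ i := by
  have h1 : ∑' i : ℕ, ξ i * (1 + i * y) ≤ ∑' i : ℕ, ξ i * (y ^ i + i) := by
    exact ENNReal.tsum_le_tsum fun i => mul_le_mul' le_rfl (one_add_mul_le_pow_add hy i)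
  rw [h.tsum_mul_one_add_mul, h.tsum_mul_pow_add, add_comm] at h1
  exact (ENNReal.add_le_add_iff_right (by simp)).1 h1

theorem lt_tsum_mul_pow (h : IsCritical ξ) {y : ℝ≥0∞} (hy : y < 1) :
    y < ∑' i, ξ i * y ^ i := by
  obtain ⟨i, hi, hξ⟩ := h.exists_two_le
  have h1 : ∑' i : ℕ, ξ i * (1 + i * y) < ∑' i : ℕ, ξ i * (y ^ i + i) := by
    refine ENNReal.tsum_lt_tsum (i := i) ?_ (fun j => ?_) ?_
    · rw [h.tsum_mul_one_add_mul]
      exact ENNReal.add_ne_top.2 ⟨by simp, hy.ne_top⟩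
    · exact mul_le_mul' le_rfl (one_add_mul_le_pow_add hy.ne_top j)
    · exact (ENNReal.mul_lt_mul_iff_right hξ (h.ne_top i)).2 (one_add_mul_lt_pow_add hy hi)
  rw [h.tsum_mul_one_add_mul, h.tsum_mul_pow_add, add_comm] at h1
  exact (ENNReal.add_lt_add_iff_right (by simp)).1 h1

theorem evalAt_one_eq_one (h : IsCritical ξ) {A : PowerSeries ℝ≥0∞}
    (hA : SolvesTreeEquation ξ A) (hle : evalAt 1 A ≤ 1) : evalAt 1 A = 1 := by
  refine hle.antisymm (not_lt.1 fun hlt => ?_)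
  have h1 := h.lt_tsum_mul_pow hlt
  have h2 := hA.evalAt_eq 1
  rw [one_mul] at h2
  exact h1.ne h2

theorem evalAt_eq_top (h : IsCritical ξ) {A : PowerSeries ℝ≥0∞}
    (hA : SolvesTreeEquation ξ A) {x : ℝ≥0∞} (hx : 1 < x) : evalAt x A = ⊤ := by
  by_contra hy
  have h1 := h.le_tsum_mul_pow hy
  have h2 := hA.evalAt_eq x
  have hy0 : evalAt x A ≠ 0 := by
    have hle : PowerSeries.coeff 1 A * x ^ 1 ≤ evalAt x A :=
      ENNReal.le_tsum (f := fun n => PowerSeries.coeff n A * x ^ n) 1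
    have h1A : ξ 0 ≤ PowerSeries.coeff 1 A := by
      rw [hA.2 0]
      simpa using ENNReal.le_tsum (f := fun i => ξ i * PowerSeries.coeff 0 (A ^ i)) 0
    intro h0
    rw [h0, nonpos_iff_eq_zero, mul_eq_zero] at hle
    rcases hle with hle | hle
    · exact h.zero_ne_zero (nonpos_iff_eq_zero.1 (hle ▸ h1A))
    · simp at hle
      simp [hle] at hx
  have h3 : x * evalAt x A ≤ 1 * evalAt x A := by
    rw [one_mul]
    conv_rhs => rw [h2]
    gcongr
  exact absurd ((ENNReal.mul_le_mul_iff_left hy0 hy).1 h3) (not_le.2 hx)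

end IsCritical

/-! ## Random walk probabilities -/

theorem evalAt_add (x : ℝ≥0∞) (φ ψ : PowerSeries ℝ≥0∞) :
    evalAt x (φ + ψ) = evalAt x φ + evalAt x ψ := by
  simp only [evalAt, map_add, add_mul, ENNReal.tsum_add]

/-- The probability that a random walk with step distribution `ξ` is at `j` at time `n`. -/
noncomputable def walkProb (ξ : ℕ → ℝ≥0∞) (n j : ℕ) : ℝ :=
  (PowerSeries.coeff j (PowerSeries.mk ξ ^ n)).toReal

theorem walkProb_nonneg (ξ : ℕ → ℝ≥0∞) (n j : ℕ) : 0 ≤ walkProb ξ n j := ENNReal.toReal_nonneg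

theorem walkProb_one (ξ : ℕ → ℝ≥0∞) (j : ℕ) : walkProb ξ 1 j = (ξ j).toReal := by
  simp [walkProb]

namespace IsCritical

variable {ξ : ℕ → ℝ≥0∞}

theorem evalAt_one_mk (h : IsCritical ξ) : evalAt 1 (PowerSeries.mk ξ) = 1 := by
  simpa [evalAt] using h.tsum_eq

theorem coeff_pow_le_one (h : IsCritical ξ) (n j : ℕ) :
    PowerSeries.coeff j (PowerSeries.mk ξ ^ n) ≤ 1 := by
  simpa [evalAt_pow, h.evalAt_one_mk] using coeff_le_evalAt_one (PowerSeries.mk ξ ^ n) j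

theorem coeff_pow_ne_top (h : IsCritical ξ) (n j : ℕ) :
    PowerSeries.coeff j (PowerSeries.mk ξ ^ n) ≠ ⊤ :=
  ((h.coeff_pow_le_one n j).trans_lt (by simp)).ne

theorem ofReal_walkProb (h : IsCritical ξ) (n j : ℕ) :
    ENNReal.ofReal (walkProb ξ n j) = PowerSeries.coeff j (PowerSeries.mk ξ ^ n) :=
  ENNReal.ofReal_toReal (h.coeff_pow_ne_top n j)

theorem walkProb_mul_le (h : IsCritical ξ) (n n' j j' : ℕ) :
    walkProb ξ n j * walkProb ξ n' j' ≤ walkProb ξ (n + n') (j + j') := by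
  unfold walkProb
  rw [← ENNReal.toReal_mul]
  refine ENNReal.toReal_mono (h.coeff_pow_ne_top _ _) ?_
  rw [pow_add, PowerSeries.coeff_mul]
  exact Finset.single_le_sum (f := fun p : ℕ × ℕ =>
    PowerSeries.coeff p.1 (PowerSeries.mk ξ ^ n) * PowerSeries.coeff p.2 (PowerSeries.mk ξ ^ n'))
    (fun _ _ => zero_le) (Finset.HasAntidiagonal.mem_antidiagonal.2
      (rfl : (j, j').1 + (j, j').2 = j + j'))

theorem walkProb_pow_le (h : IsCritical ξ) (n j q : ℕ) :
    walkProb ξ n j ^ q ≤ walkProb ξ (q * n) (q * j) := by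
  induction q with
  | zero => simp [walkProb]
  | succ q ih =>
    rw [pow_succ, add_mul, add_mul, one_mul, one_mul]
    exact (mul_le_mul_of_nonneg_right ih (walkProb_nonneg _ _ _)).trans (h.walkProb_mul_le _ _ _ _)

/-- Otherwise the generating function of the tree size would have radius of convergence
larger than `1`. -/
theorem exists_exp_le_walkProb_diag (h : IsCritical ξ) {A : PowerSeries ℝ≥0∞}
    (hA : SolvesTreeEquation ξ A) {δ : ℝ} (hδ : 0 < δ) :
    ∃ M : ℕ, 0 < M ∧ Real.exp (-(2 * δ)) ^ M ≤ walkProb ξ M M := by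
  by_contra! hc
  set θ := Real.exp (-(2 * δ)) with hθ
  have hθ0 : 0 < θ := Real.exp_pos _
  have hθ1 : θ ≤ 1 := Real.exp_le_one_iff.2 (by linarith)
  obtain ⟨i, hi, hξ⟩ := h.exists_two_le
  obtain ⟨l, rfl⟩ : ∃ l, i = l + 2 := ⟨i - 2, by omega⟩
  have hξ0 : 0 < (ξ (l + 2)).toReal := ENNReal.toReal_pos hξ (h.ne_top _)
  set K : ℝ := max 1 (ξ (l + 2)).toReal⁻¹ with hK
  have hbound : ∀ n, walkProb ξ (n + 1) n ≤ K * θ ^ (n + 1) := by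
    intro n
    have h1 : walkProb ξ (n + 1) n ^ (l + 1) * (ξ (l + 2)).toReal ≤ (θ ^ (n + 1)) ^ (l + 1) := by
      calc walkProb ξ (n + 1) n ^ (l + 1) * (ξ (l + 2)).toReal
          ≤ walkProb ξ ((l + 1) * (n + 1) + 1) ((l + 1) * n + (l + 2)) := by
            rw [← walkProb_one]
            exact (mul_le_mul_of_nonneg_right (h.walkProb_pow_le _ _ _)
              (walkProb_nonneg _ _ _)).trans (h.walkProb_mul_le _ _ _ _)
        _ = walkProb ξ ((l + 1) * (n + 1) + 1) ((l + 1) * (n + 1) + 1) := by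
            congr 1
        _ ≤ θ ^ ((l + 1) * (n + 1) + 1) := (hc _ (by omega)).le
        _ ≤ θ ^ ((n + 1) * (l + 1)) :=
            pow_le_pow_of_le_one hθ0.le hθ1 (by rw [mul_comm]; omega)
        _ = _ := pow_mul _ _ _
    by_cases hle : walkProb ξ (n + 1) n ≤ θ ^ (n + 1)
    · exact hle.trans (le_mul_of_one_le_left (by positivity) (le_max_left _ _))
    · have hz : 1 ≤ walkProb ξ (n + 1) n / θ ^ (n + 1) := by
        rw [one_le_div (by positivity)]
        exact (not_le.1 hle).le
      rw [← div_le_iff₀ (by positivity)]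
      refine (le_self_pow₀ hz (Nat.succ_ne_zero l)).trans (le_trans ?_ (le_max_right _ _))
      rw [div_pow, div_le_iff₀ (by positivity), inv_mul_eq_div, le_div_iff₀ hξ0]
      exact h1
  have hA1 : ∀ n, PowerSeries.coeff n A ≤ ENNReal.ofReal (K * θ ^ n) := by
    intro n
    rcases n with _ | n
    · rw [hA.1]; exact zero_le
    · have h1 := hA.lagrange_inversion (n + 1) 1 n rfl
      rw [pow_one, Nat.cast_one, one_mul, ← h.ofReal_walkProb] at h1
      calc PowerSeries.coeff (n + 1) A ≤ ((n + 1 : ℕ) : ℝ≥0∞) * PowerSeries.coeff (n + 1) A :=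
            le_mul_of_one_le_left' (by exact_mod_cast Nat.succ_pos n)
        _ ≤ _ := h1 ▸ ENNReal.ofReal_le_ofReal (hbound n)
  have htop := h.evalAt_eq_top hA (x := ENNReal.ofReal (Real.exp δ))
    (by rw [ENNReal.one_lt_ofReal]; exact Real.one_lt_exp_iff.2 hδ)
  have hK0 : 0 ≤ K := zero_le_one.trans (le_max_left _ _)
  have hsum : Summable fun n : ℕ => K * Real.exp (-δ) ^ n :=
    (summable_geometric_of_lt_one (Real.exp_pos _).le
      (Real.exp_lt_one_iff.2 (by linarith))).mul_left K
  refine hsum.tsum_ofReal_ne_top (top_unique (htop ▸ ?_))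
  refine ENNReal.tsum_le_tsum fun n => ?_
  calc PowerSeries.coeff n A * ENNReal.ofReal (Real.exp δ) ^ n
      ≤ ENNReal.ofReal (K * θ ^ n) * ENNReal.ofReal (Real.exp δ) ^ n := by gcongr; exact hA1 n
    _ = ENNReal.ofReal (K * Real.exp (-δ) ^ n) := by
      rw [← ENNReal.ofReal_pow (Real.exp_pos _).le, ← ENNReal.ofReal_mul (by positivity),
        mul_assoc, ← mul_pow, hθ, ← Real.exp_add]
      congr 4
      ring

/-- Point probabilities of the walk close to its mean do not decay exponentially. -/
theorem exists_exp_le_walkProb (h : IsCritical ξ) {A : PowerSeries ℝ≥0∞}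
    (hA : SolvesTreeEquation ξ A) (e c : ℕ) {δ : ℝ} (hδ : 0 < δ) :
    ∃ N : ℕ, ∀ n, N ≤ n → ∀ j, n + e = j + c → 0 < walkProb ξ n j →
      Real.exp (-(δ * n)) ≤ walkProb ξ n j := by
  obtain ⟨M, hM, hdiag⟩ := h.exists_exp_le_walkProb_diag hA (δ := δ / 4) (by linarith)
  set θ := Real.exp (-(2 * (δ / 4))) with hθ
  have hθ0 : 0 < θ := Real.exp_pos _
  have hθ1 : θ ≤ 1 := Real.exp_le_one_iff.2 (by linarith)
  have hclass : ∀ r : Fin M, ∃ κ > 0, ∀ n j, n % M = r → n + e = j + c → 0 < walkProb ξ n j →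
      κ * θ ^ n ≤ walkProb ξ n j := by
    intro r
    by_cases hex : ∃ n, n % M = r ∧ ∃ j, n + e = j + c ∧ 0 < walkProb ξ n j
    · classical
      obtain ⟨hr, j₀, hj₀, hpos⟩ := Nat.find_spec hex
      refine ⟨_, hpos, fun n j hn hj hp => ?_⟩
      have hmin : Nat.find hex ≤ n := Nat.find_min' hex ⟨hn, j, hj, hp⟩
      set n₀ := Nat.find hex
      obtain ⟨q, hq⟩ : M ∣ n - n₀ := (Nat.modEq_iff_dvd' hmin).1 (hr.trans hn.symm)
      obtain rfl : n = n₀ + q * M := by rw [mul_comm]; omega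
      obtain rfl : j = j₀ + q * M := by omega
      refine le_trans ?_ (h.walkProb_mul_le _ _ _ _)
      refine mul_le_mul_of_nonneg_left ?_ hpos.le
      calc θ ^ (n₀ + q * M) ≤ θ ^ (M * q) :=
            pow_le_pow_of_le_one hθ0.le hθ1 (by rw [mul_comm]; omega)
        _ = (θ ^ M) ^ q := pow_mul _ _ _
        _ ≤ walkProb ξ M M ^ q := by gcongr
        _ ≤ _ := h.walkProb_pow_le _ _ _
    · refine ⟨1, one_pos, fun n j hn hj hp => ?_⟩
      exact absurd ⟨n, hn, j, hj, hp⟩ hex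
  choose κ hκ0 hκ using hclass
  have hev : ∀ r : Fin M, ∀ᶠ n : ℕ in atTop, Real.exp (-(δ * n)) ≤ κ r * θ ^ n := by
    intro r
    have ht : Tendsto (fun n : ℕ => θ ^ n) atTop (𝓝 0) :=
      tendsto_pow_atTop_nhds_zero_of_lt_one hθ0.le (Real.exp_lt_one_iff.2 (by linarith))
    filter_upwards [ht.eventually (ge_mem_nhds (hκ0 r))] with n hn
    calc Real.exp (-(δ * n)) = θ ^ n * θ ^ n := by
          rw [hθ, ← mul_pow, ← Real.exp_add, ← Real.exp_nat_mul]
          congr 1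
          ring
      _ ≤ _ := by gcongr
  obtain ⟨N, hN⟩ := eventually_atTop.1 (eventually_all.2 hev)
  exact ⟨N, fun n hn j hj hp =>
    (hN n hn ⟨n % M, Nat.mod_lt _ hM⟩).trans (hκ ⟨n % M, Nat.mod_lt _ hM⟩ n j rfl hj hp)⟩

end IsCritical

/-! ## The strong ratio limit theorem -/

/-- Jensen's inequality for the exponential function and a finite weighted sum over `ℕ`. -/
theorem mul_exp_le_sum_of_mean (w : ℕ → ℝ) (hw : ∀ k, 0 ≤ w k) (s : Finset ℕ) (L W m : ℝ)
    (hW : ∑ k ∈ s, w k = W) (hm : ∑ k ∈ s, k * w k = m * W) :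
    W * Real.exp (L * m) ≤ ∑ k ∈ s, Real.exp L ^ k * w k := by
  have h1 : ∀ k ∈ s, Real.exp (L * m) * (1 + L * (k - m)) * w k ≤ Real.exp L ^ k * w k := by
    intro k _
    refine mul_le_mul_of_nonneg_right ?_ (hw k)
    calc Real.exp (L * m) * (1 + L * (k - m))
        ≤ Real.exp (L * m) * Real.exp (L * (k - m)) := by
          gcongr
          rw [add_comm]
          exact Real.add_one_le_exp _
      _ = Real.exp L ^ k := by
          rw [← Real.exp_add, ← Real.exp_nat_mul]
          congr 1
          ring
  refine le_trans (le_of_eq ?_) (Finset.sum_le_sum h1)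
  have h2 : ∀ k : ℕ, Real.exp (L * m) * (1 + L * (k - m)) * w k =
      Real.exp (L * m) * (1 - L * m) * w k + Real.exp (L * m) * L * (k * w k) := fun k => by ring
  simp_rw [h2]
  rw [Finset.sum_add_distrib, ← Finset.mul_sum, ← Finset.mul_sum, hW, hm]
  ring

theorem sum_mul_choose_mul_pow {R : Type*} [CommSemiring R] (x y : R) (n : ℕ) :
    ∑ k ∈ Finset.range (n + 2), (k : R) * (x ^ k * y ^ (n + 1 - k) * (n + 1).choose k) =
      (n + 1) * (x * (x + y) ^ n) := by
  rw [Finset.sum_range_succ', add_pow, Finset.mul_sum, Finset.mul_sum]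
  simp only [Nat.cast_zero, zero_mul, add_zero, Nat.add_sub_add_right]
  refine Finset.sum_congr rfl fun k _ => ?_
  have h : ((n : R) + 1) * n.choose k = (n + 1).choose (k + 1) * (k + 1) := by
    exact_mod_cast congrArg (Nat.cast (R := R)) (Nat.add_one_mul_choose_eq n k)
  calc ((k + 1 : ℕ) : R) * (x ^ (k + 1) * y ^ (n - k) * (n + 1).choose (k + 1))
      = x ^ (k + 1) * y ^ (n - k) * ((n + 1).choose (k + 1) * (k + 1)) := by push_cast; ring
    _ = _ := by rw [← h]; ring

namespace IsCritical

variable {ξ : ℕ → ℝ≥0∞}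

/-- The number of steps equal to `i` in a walk of `n + 1` steps ending at `j + i` has conditional
mean `(n + 1) * ξ i * walkProb ξ n j / walkProb ξ (n + 1) (j + i)`, and its exponential moments
are controlled by those of a binomial variable. -/
theorem mul_ratio_le (h : IsCritical ξ) (n i j : ℕ) (L : ℝ)
    (hp : 0 < walkProb ξ (n + 1) (j + i)) :
    L * ((n + 1) * (ξ i).toReal * (walkProb ξ n j / walkProb ξ (n + 1) (j + i))) ≤
      (n + 1) * ((Real.exp L - 1) * (ξ i).toReal) - Real.log (walkProb ξ (n + 1) (j + i)) := by
  set M : PowerSeries ℝ≥0∞ := PowerSeries.C (ξ i) * PowerSeries.X ^ i with hM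
  set G : PowerSeries ℝ≥0∞ := PowerSeries.mk fun l => if l = i then 0 else ξ l with hG
  have hMG : M + G = PowerSeries.mk ξ := by
    ext l
    by_cases hl : l = i <;> simp [hM, hG, PowerSeries.coeff_X_pow, hl]
  set w : ℕ → ℝ≥0∞ := fun k =>
    PowerSeries.coeff (j + i) (M ^ k * G ^ (n + 1 - k) * ((n + 1).choose k : PowerSeries ℝ≥0∞))
    with hw
  have hcast : ∀ (a : ℕ) (φ : PowerSeries ℝ≥0∞) (l : ℕ),
      PowerSeries.coeff l ((a : PowerSeries ℝ≥0∞) * φ) = a * PowerSeries.coeff l φ := by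
    intro a φ l
    rw [← map_natCast (PowerSeries.C (R := ℝ≥0∞)), PowerSeries.coeff_C_mul]
  have hW : ∑ k ∈ Finset.range (n + 2), w k =
      PowerSeries.coeff (j + i) (PowerSeries.mk ξ ^ (n + 1)) := by
    rw [← hMG, add_pow, map_sum]
  have hm : ∑ k ∈ Finset.range (n + 2), (k : ℝ≥0∞) * w k =
      (n + 1) * (ξ i * PowerSeries.coeff j (PowerSeries.mk ξ ^ n)) := by
    simp only [hw, ← hcast]
    rw [← map_sum, sum_mul_choose_mul_pow, hMG, ← Nat.cast_add_one, hcast, hM, mul_assoc,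
      PowerSeries.coeff_C_mul, PowerSeries.coeff_X_pow_mul]
    push_cast
    rfl
  have hfin : ∀ k ∈ Finset.range (n + 2), w k ≠ ⊤ := by
    intro k hk
    refine ne_top_of_le_ne_top (h.coeff_pow_ne_top (n + 1) (j + i)) ?_
    rw [← hW]
    exact Finset.single_le_sum (f := w) (fun _ _ => zero_le) hk
  have hu : ∑ k ∈ Finset.range (n + 2), ENNReal.ofReal (Real.exp L) ^ k * w k ≤
      ENNReal.ofReal (Real.exp ((n + 1) * ((Real.exp L - 1) * (ξ i).toReal))) := by
    set u := ENNReal.ofReal (Real.exp L) with hu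
    have h1 : ∑ k ∈ Finset.range (n + 2), u ^ k * w k =
        PowerSeries.coeff (j + i) ((PowerSeries.C u * M + G) ^ (n + 1)) := by
      rw [add_pow, map_sum]
      refine Finset.sum_congr rfl fun k _ => ?_
      rw [mul_pow, ← map_pow, mul_assoc, mul_assoc, PowerSeries.coeff_C_mul]
      simp only [hw, mul_assoc]
    have hGe : evalAt 1 G + ξ i = 1 := by
      have h2 := h.evalAt_one_mk
      rwa [← hMG, evalAt_add, hM, evalAt_mul, evalAt_C, evalAt_pow, evalAt_X, one_pow, mul_one,
        add_comm] at h2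
    have hGt : evalAt 1 G ≠ ⊤ := by
      intro ht
      simp [ht] at hGe
    rw [h1]
    refine (coeff_le_evalAt_one _ _).trans ?_
    rw [evalAt_pow, evalAt_add, hM, evalAt_mul, evalAt_mul, evalAt_C, evalAt_C, evalAt_pow,
      evalAt_X, one_pow, mul_one, hu, ← ENNReal.ofReal_toReal (h.ne_top i),
      ← ENNReal.ofReal_toReal hGt, ← ENNReal.ofReal_mul (Real.exp_pos _).le,
      ← ENNReal.ofReal_add (by positivity) (by positivity), ← ENNReal.ofReal_pow (by positivity)]
    refine ENNReal.ofReal_le_ofReal ?_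
    have hGe' : (evalAt 1 G).toReal + (ξ i).toReal = 1 := by
      rw [← ENNReal.toReal_add hGt (h.ne_top i), hGe, ENNReal.toReal_one]
    rw [ENNReal.toReal_ofReal ENNReal.toReal_nonneg,
      show ((n : ℝ) + 1) = ((n + 1 : ℕ) : ℝ) by push_cast; rfl, Real.exp_nat_mul]
    gcongr
    refine le_trans (le_of_eq ?_) (Real.add_one_le_exp _)
    linear_combination hGe'
  have hj := mul_exp_le_sum_of_mean (fun k => (w k).toReal) (fun _ => ENNReal.toReal_nonneg)
    (Finset.range (n + 2)) L (walkProb ξ (n + 1) (j + i))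
    ((n + 1) * (ξ i).toReal * (walkProb ξ n j / walkProb ξ (n + 1) (j + i)))
    (by rw [← ENNReal.toReal_sum hfin, hW]; rfl)
    (by
      have h2 := congrArg ENNReal.toReal hm
      rw [ENNReal.toReal_sum fun k hk => ENNReal.mul_ne_top (by simp) (hfin k hk)] at h2
      simp only [ENNReal.toReal_mul, ENNReal.toReal_natCast] at h2
      rw [h2, mul_assoc, mul_assoc, div_mul_cancel₀ _ hp.ne']
      have : ((n : ℝ≥0∞) + 1).toReal = n + 1 := by
        rw [← Nat.cast_add_one, ENNReal.toReal_natCast]; push_cast; rfl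
      rw [this]
      rfl)
  have hu' : ∑ k ∈ Finset.range (n + 2), Real.exp L ^ k * (w k).toReal ≤
      Real.exp ((n + 1) * ((Real.exp L - 1) * (ξ i).toReal)) := by
    have h2 := ENNReal.toReal_mono ENNReal.ofReal_ne_top hu
    rw [ENNReal.toReal_sum fun k hk =>
      ENNReal.mul_ne_top (ENNReal.pow_ne_top ENNReal.ofReal_ne_top) (hfin k hk)] at h2
    simpa [ENNReal.toReal_ofReal, Real.exp_nonneg] using h2
  have h3 := Real.log_le_log (mul_pos hp (Real.exp_pos _)) (hj.trans hu')
  rw [Real.log_mul hp.ne' (Real.exp_pos _).ne', Real.log_exp, Real.log_exp] at h3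
  linarith

theorem abs_ratio_sub_one_le (h : IsCritical ξ) {A : PowerSeries ℝ≥0∞}
    (hA : SolvesTreeEquation ξ A) (e c : ℕ) {i : ℕ} (hi : ξ i ≠ 0) {ε : ℝ} (hε : 0 < ε) :
    ∃ N : ℕ, ∀ n, N ≤ n → ∀ j, n + e = j + c → 0 < walkProb ξ (n + 1) (j + i) →
      |walkProb ξ n j / walkProb ξ (n + 1) (j + i) - 1| ≤ ε := by
  have hξ : 0 < (ξ i).toReal := ENNReal.toReal_pos hi (h.ne_top i)
  set η := min (ε / 2) 1 with hη
  have hη0 : 0 < η := lt_min (by linarith) one_pos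
  have hη1 : η ≤ 1 := min_le_right _ _
  have hηε : 2 * η ≤ ε := by linarith [min_le_left (ε / 2) 1]
  obtain ⟨N, hN⟩ := h.exists_exp_le_walkProb hA (e + i) (c + 1)
    (δ := (ξ i).toReal * η ^ 2) (by positivity)
  refine ⟨N, fun n hn j hj hp => ?_⟩
  have hlow := hN (n + 1) (by omega) (j + i) (by omega) hp
  have hlog : -((ξ i).toReal * η ^ 2 * (n + 1)) ≤ Real.log (walkProb ξ (n + 1) (j + i)) := by
    have := Real.log_le_log (Real.exp_pos _) hlow
    rw [Real.log_exp] at this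
    exact_mod_cast this
  set r := walkProb ξ n j / walkProb ξ (n + 1) (j + i) with hr
  have hn0 : (0 : ℝ) < n + 1 := by positivity
  have key : ∀ L : ℝ, |L| = η → L * r ≤ L + 2 * η ^ 2 := by
    intro L hL
    have h1 := h.mul_ratio_le n i j L hp
    have h2 := (abs_le.1 (Real.abs_exp_sub_one_sub_id_le (x := L) (by rw [hL]; exact hη1))).2
    rw [← sq_abs L, hL] at h2
    have h3 : L * ((n + 1) * (ξ i).toReal * r) ≤
        (n + 1) * ((L + η ^ 2) * (ξ i).toReal) + (ξ i).toReal * η ^ 2 * (n + 1) := by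
      have : ((n : ℝ) + 1) * ((Real.exp L - 1) * (ξ i).toReal) ≤
          (n + 1) * ((L + η ^ 2) * (ξ i).toReal) := by
        gcongr
        linarith
      linarith
    refine le_of_mul_le_mul_left (a := ((n : ℝ) + 1) * (ξ i).toReal) ?_ (by positivity)
    linarith
  have h1 := key η (abs_of_pos hη0)
  have h2 := key (-η) (by rw [abs_neg, abs_of_pos hη0])
  rw [abs_le]
  constructor
  · refine le_of_mul_le_mul_left (a := η) ?_ hη0
    nlinarith
  · refine le_of_mul_le_mul_left (a := η) ?_ hη0
    nlinarith

theorem tendsto_walkProb_div (h : IsCritical ξ) {A : PowerSeries ℝ≥0∞}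
    (hA : SolvesTreeEquation ξ A) {ι : Type*} {l : Filter ι} {N J : ι → ℕ}
    (hN : Tendsto N l atTop) (ds : Multiset ℕ) (hds : ∀ d ∈ ds, ξ d ≠ 0) (e c : ℕ)
    (hNJ : ∀ᶠ x in l, N x + e = J x + c)
    (hpos : ∀ᶠ x in l, 0 < walkProb ξ (N x + Multiset.card ds) (J x + ds.sum)) :
    Tendsto (fun x => walkProb ξ (N x) (J x) /
      walkProb ξ (N x + Multiset.card ds) (J x + ds.sum)) l (𝓝 1) := by
  induction ds using Multiset.induction with
  | empty =>
    simp only [Multiset.card_zero, Multiset.sum_zero, add_zero] at hpos ⊢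
    refine (tendsto_congr' ?_).2 tendsto_const_nhds
    filter_upwards [hpos] with x hx
    exact div_self hx.ne'
  | cons i ds ih =>
    have hlast : Tendsto (fun x => walkProb ξ (N x + Multiset.card ds) (J x + ds.sum) /
        walkProb ξ (N x + Multiset.card ds + 1) (J x + ds.sum + i)) l (𝓝 1) := by
      rw [Metric.tendsto_nhds]
      intro ε hε
      obtain ⟨n₀, hn₀⟩ := h.abs_ratio_sub_one_le hA (e + ds.sum) (c + Multiset.card ds)
        (hds i (Multiset.mem_cons_self i ds)) (half_pos hε)
      filter_upwards [hN.eventually_ge_atTop n₀, hNJ, hpos] with x hx hxJ hxp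
      rw [Real.dist_eq]
      refine (hn₀ _ (by omega) _ (by omega) ?_).trans_lt (half_lt_self hε)
      rw [Multiset.card_cons, Multiset.sum_cons] at hxp
      rwa [add_assoc, add_assoc, add_comm ds.sum]
    have hpos' : ∀ᶠ x in l, 0 < walkProb ξ (N x + Multiset.card ds) (J x + ds.sum) := by
      filter_upwards [hlast.eventually (lt_mem_nhds one_pos)] with x hx
      refine lt_of_le_of_ne (walkProb_nonneg _ _ _) fun h0 => ?_
      rw [← h0, zero_div] at hx
      exact lt_irrefl _ hx
    have := (ih (fun d hd => hds d (Multiset.mem_cons_of_mem hd)) hpos').mul hlast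
    rw [one_mul] at this
    refine this.congr' ?_
    filter_upwards [hpos'] with x hx
    rw [div_mul_div_cancel₀ hx.ne', Multiset.card_cons, Multiset.sum_cons, add_assoc, add_assoc,
      add_comm ds.sum]

theorem coeff_pow_eq_ofReal (h : IsCritical ξ) {A : PowerSeries ℝ≥0∞}
    (hA : SolvesTreeEquation ξ A) {n : ℕ} (hn : 0 < n) {m j : ℕ} (hj : j + m = n) :
    PowerSeries.coeff n (A ^ m) = ENNReal.ofReal (m * walkProb ξ n j / n) := by
  have h1 := hA.lagrange_inversion n m j hj
  have hn' : (0 : ℝ) < n := by exact_mod_cast hn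
  rw [ENNReal.ofReal_div_of_pos hn', ENNReal.ofReal_mul (Nat.cast_nonneg m), h.ofReal_walkProb,
    ENNReal.ofReal_natCast, ENNReal.ofReal_natCast, ← h1,
    mul_comm, ENNReal.mul_div_cancel_right (by exact_mod_cast hn.ne') (ENNReal.natCast_ne_top n)]

theorem tendsto_coeff_div_coeff (h : IsCritical ξ) {A : PowerSeries ℝ≥0∞}
    (hA : SolvesTreeEquation ξ A) (ds : Multiset ℕ) (hds : ∀ d ∈ ds, ξ d ≠ 0) (m : ℕ)
    (hm : ds.sum + 1 = Multiset.card ds + m) :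
    Tendsto (fun n => PowerSeries.coeff n (PowerSeries.X ^ Multiset.card ds * A ^ m) /
        PowerSeries.coeff n A)
      (atTop ⊓ 𝓟 {n | 0 < PowerSeries.coeff n A}) (𝓝 (m : ℝ≥0∞)) := by
  set l : Filter ℕ := atTop ⊓ 𝓟 {n | 0 < PowerSeries.coeff n A}
  have hl : l ≤ atTop := inf_le_left
  have hpos : ∀ᶠ n in l, 0 < PowerSeries.coeff n A := mem_inf_of_right (mem_principal_self _)
  have hlarge : ∀ᶠ n in l, ds.sum + 1 + Multiset.card ds ≤ n := hl (eventually_ge_atTop _)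
  have ha : ∀ n, 0 < n → PowerSeries.coeff n A = ENNReal.ofReal (walkProb ξ n (n - 1) / n) := by
    intro n hn
    have := h.coeff_pow_eq_ofReal hA hn (m := 1) (j := n - 1) (by omega)
    simpa using this
  have hN : Tendsto (fun n : ℕ => n - Multiset.card ds) l atTop :=
    (tendsto_sub_atTop_nat _).mono_left hl
  have hratio := h.tendsto_walkProb_div hA hN ds hds (ι := ℕ) (J := fun n => n - 1 - ds.sum)
    0 m (by filter_upwards [hlarge] with n hn; omega)
    (by
      filter_upwards [hlarge, hpos] with n hn hp
      rw [ha n (by omega), ENNReal.ofReal_pos] at hp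
      rw [Nat.sub_add_cancel (by omega), Nat.sub_add_cancel (by omega)]
      by_contra hc
      rw [le_antisymm (not_lt.1 hc) (walkProb_nonneg _ _ _), zero_div] at hp
      exact lt_irrefl _ hp)
  have hfrac : Tendsto (fun n : ℕ => 1 + (Multiset.card ds : ℝ) / ((n - Multiset.card ds : ℕ) : ℝ))
      l (𝓝 (1 + 0)) :=
    ((tendsto_const_div_atTop_nhds_zero_nat _).comp hN).const_add 1
  have hlim := ENNReal.tendsto_ofReal ((hfrac.mul hratio).const_mul (m : ℝ))
  rw [add_zero, mul_one, mul_one, ENNReal.ofReal_natCast] at hlim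
  refine hlim.congr' ?_
  filter_upwards [hlarge, hpos] with n hn hp
  obtain ⟨N, rfl⟩ : ∃ N, n = N + Multiset.card ds := ⟨n - Multiset.card ds, by omega⟩
  rw [ha _ (by omega)] at hp ⊢
  rw [PowerSeries.coeff_X_pow_mul, h.coeff_pow_eq_ofReal hA (by omega)
    (j := N + Multiset.card ds - 1 - ds.sum) (by omega),
    ← ENNReal.ofReal_div_of_pos (ENNReal.ofReal_pos.1 hp), Nat.add_sub_cancel,
    Nat.sub_add_cancel (by omega : ds.sum ≤ N + Multiset.card ds - 1)]
  congr 1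
  have hN0 : (N : ℝ) ≠ 0 := by
    have : 0 < N := by omega
    exact_mod_cast this.ne'
  push_cast
  have hNb : (N : ℝ) + Multiset.card ds ≠ 0 := by positivity
  have hp0 : walkProb ξ (N + Multiset.card ds) (N + Multiset.card ds - 1) ≠ 0 := by
    intro h0
    rw [h0, zero_div, ENNReal.ofReal_zero] at hp
    exact lt_irrefl _ hp
  field_simp

end IsCritical

/-! ## Generating functions of weighted classes -/

/-- The generating function of the class `α`, where `a : α` has weight `f a` and size `s a`. -/
noncomputable def genFun {α : Type*} (f : α → ℝ≥0∞) (s : α → ℕ) : PowerSeries ℝ≥0∞ :=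
  PowerSeries.mk fun n => ∑' a, if s a = n then f a else 0

theorem evalAt_one_genFun {α : Type*} (f : α → ℝ≥0∞) (s : α → ℕ) :
    evalAt 1 (genFun f s) = ∑' a, f a := by
  simp only [evalAt, genFun, PowerSeries.coeff_mk, one_pow, mul_one]
  rw [ENNReal.tsum_comm]
  exact tsum_congr fun a => by simp only [eq_comm (a := s a), tsum_ite_eq]

theorem genFun_equiv {α β : Type*} (e : α ≃ β) (f : β → ℝ≥0∞) (s : β → ℕ) :
    genFun (fun a => f (e a)) (fun a => s (e a)) = genFun f s := by
  ext n
  simp only [genFun, PowerSeries.coeff_mk]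
  exact e.tsum_eq fun b => if s b = n then f b else 0

theorem genFun_const_mul {α : Type*} (c : ℝ≥0∞) (f : α → ℝ≥0∞) (s : α → ℕ) :
    genFun (fun a => c * f a) s = PowerSeries.C c * genFun f s := by
  ext n
  simp only [genFun, PowerSeries.coeff_mk, PowerSeries.coeff_C_mul, ← ENNReal.tsum_mul_left,
    mul_ite, mul_zero]

theorem genFun_add_one {α : Type*} (f : α → ℝ≥0∞) (s : α → ℕ) :
    genFun f (fun a => s a + 1) = PowerSeries.X * genFun f s := by
  ext n
  rcases n with _ | n
  · simp [genFun]
  · rw [PowerSeries.coeff_succ_X_mul]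
    simp [genFun]

theorem genFun_prod {α β : Type*} (f : α → ℝ≥0∞) (s : α → ℕ) (g : β → ℝ≥0∞) (t : β → ℕ) :
    genFun (fun p : α × β => f p.1 * g p.2) (fun p => s p.1 + t p.2) =
      genFun f s * genFun g t := by
  ext n
  simp only [genFun, PowerSeries.coeff_mk, PowerSeries.coeff_mul, ← ENNReal.tsum_mul_right]
  simp only [← ENNReal.tsum_mul_left]
  simp only [← ENNReal.tsum_prod (f := fun a b =>
    (if s a = _ then f a else 0) * (if t b = _ then g b else 0))]
  rw [← Summable.tsum_finsetSum fun _ _ => ENNReal.summable]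
  refine tsum_congr fun p => ?_
  by_cases h : s p.1 + t p.2 = n
  · rw [if_pos h, Finset.sum_eq_single (s p.1, t p.2)]
    · simp
    · rintro ⟨i, j⟩ _ hne
      by_cases hi : s p.1 = i
      · by_cases hj : t p.2 = j
        · exact absurd (by rw [hi, hj]) hne
        · simp [hj]
      · simp [hi]
    · intro hn
      exact absurd (Finset.HasAntidiagonal.mem_antidiagonal.2 h) hn
  · rw [if_neg h, Finset.sum_eq_zero]
    rintro ⟨i, j⟩ hij
    rw [Finset.HasAntidiagonal.mem_antidiagonal] at hij
    by_cases hi : s p.1 = i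
    · by_cases hj : t p.2 = j
      · exact absurd (by rw [hi, hj, hij]) h
      · simp [hj]
    · simp [hi]

theorem genFun_pi {α : Type*} (s : α → ℕ) {d : ℕ} (f : Fin d → α → ℝ≥0∞) :
    genFun (fun x : Fin d → α => ∏ i, f i (x i)) (fun x => ∑ i, s (x i)) =
      ∏ i, genFun (f i) s := by
  induction d with
  | zero =>
    ext n
    simp only [genFun, PowerSeries.coeff_mk, Finset.univ_eq_empty, Finset.prod_empty,
      Finset.sum_empty, PowerSeries.coeff_one, tsum_fintype]
    simp [eq_comm]
  | succ d ih =>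
    rw [Fin.prod_univ_succ, ← ih, ← genFun_prod,
      ← genFun_equiv (Fin.consEquiv fun _ : Fin (d + 1) => α)]
    simp [Fin.consEquiv, Fin.prod_univ_succ, Fin.sum_univ_succ]

theorem coeff_genFun_sigma {ι : Type*} {β : ι → Type*} (f : (Σ i, β i) → ℝ≥0∞)
    (s : (Σ i, β i) → ℕ) (n : ℕ) :
    PowerSeries.coeff n (genFun f s) =
      ∑' i, PowerSeries.coeff n (genFun (fun b => f ⟨i, b⟩) fun b => s ⟨i, b⟩) := by
  simp only [genFun, PowerSeries.coeff_mk]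
  exact ENNReal.tsum_sigma' _

/-! ## Finite trees -/

/-- Finite rooted ordered trees. -/
abbrev FinTree : Type := {t : Finset Vertex // IsTree (t : Set Vertex)}

namespace FinTree

/-- The tree whose root has `d` children, the `i`-th of which is the root of a copy of `s i`. -/
def graftVertices {d : ℕ} (s : Fin d → Finset Vertex) : Finset Vertex :=
  insert [] (Finset.univ.biUnion fun i : Fin d => (s i).image (List.cons (i : ℕ)))

theorem nil_mem_graftVertices {d : ℕ} (s : Fin d → Finset Vertex) : [] ∈ graftVertices s :=
  Finset.mem_insert_self _ _

theorem cons_mem_graftVertices {d : ℕ} (s : Fin d → Finset Vertex) (a : ℕ) (u : Vertex) :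
    a :: u ∈ graftVertices s ↔ ∃ h : a < d, u ∈ s ⟨a, h⟩ := by
  simp only [graftVertices, Finset.mem_insert, Finset.mem_biUnion, Finset.mem_image,
    Finset.mem_univ, true_and, List.cons.injEq, reduceCtorEq, false_or]
  constructor
  · rintro ⟨i, v, hv, rfl, rfl⟩
    exact ⟨i.2, hv⟩
  · rintro ⟨h, hu⟩
    exact ⟨⟨a, h⟩, u, hu, rfl, rfl⟩

/-- The tree whose root has `d` children, the `i`-th of which is the root of a copy of `s i`. -/
def graft (p : Σ d : ℕ, Fin d → FinTree) : FinTree :=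
  ⟨graftVertices fun i => (p.2 i).1, by
    obtain ⟨d, s⟩ := p
    refine ⟨nil_mem_graftVertices _, ?_, ?_⟩
    · rintro (_ | ⟨a, u⟩) v h
      · exact nil_mem_graftVertices _
      · obtain ⟨ha, hu⟩ := (cons_mem_graftVertices _ _ _).1 h
        exact (cons_mem_graftVertices _ _ _).2 ⟨ha, (s ⟨a, ha⟩).2.2.1 u v hu⟩
    · rintro (_ | ⟨a, u⟩) i j h hj
      · obtain ⟨ha, -⟩ := (cons_mem_graftVertices _ _ _).1 h
        exact (cons_mem_graftVertices _ _ _).2 ⟨hj.trans_lt ha, (s ⟨j, _⟩).2.1⟩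
      · obtain ⟨ha, hu⟩ := (cons_mem_graftVertices _ _ _).1 h
        exact (cons_mem_graftVertices _ _ _).2 ⟨ha, (s ⟨a, ha⟩).2.2.2 u i j hu hj⟩⟩

theorem nil_mem (t : FinTree) : [] ∈ t.1 := t.2.1

theorem cons_mem_graft {d : ℕ} (s : Fin d → FinTree) (a : ℕ) (u : Vertex) :
    a :: u ∈ (graft ⟨d, s⟩).1 ↔ ∃ h : a < d, u ∈ (s ⟨a, h⟩).1 :=
  cons_mem_graftVertices _ _ _

theorem graft_injective : Function.Injective graft := by
  rintro ⟨d, s⟩ ⟨d', s'⟩ h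
  have hmem : ∀ a u, (∃ h : a < d, u ∈ (s ⟨a, h⟩).1) ↔ ∃ h : a < d', u ∈ (s' ⟨a, h⟩).1 := by
    intro a u
    rw [← cons_mem_graft, ← cons_mem_graft, h]
  have hd : ∀ a, a < d ↔ a < d' := fun a => by
    have := hmem a []
    simpa [nil_mem] using this
  obtain rfl : d = d' := le_antisymm (not_lt.1 fun hlt => lt_irrefl _ ((hd _).1 hlt))
    (not_lt.1 fun hlt => lt_irrefl _ ((hd _).2 hlt))
  congr 1
  funext i
  ext u
  have := hmem i u
  simpa using this

theorem graft_surjective : Function.Surjective graft := by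
  intro t
  have hex : ∃ i : ℕ, [i] ∉ t.1 := by
    by_contra! hc
    exact Set.infinite_of_injective_forall_mem (f := fun i : ℕ => ([i] : Vertex))
      (fun i j h => by simpa using h) hc t.1.finite_toSet
  classical
  have hlt : ∀ i, [i] ∈ t.1 ↔ i < Nat.find hex := by
    intro i
    constructor
    · intro hi
      by_contra hc
      exact Nat.find_spec hex (t.2.2.2 [] i _ hi (not_lt.1 hc))
    · intro hi
      exact not_not.1 (Nat.find_min hex hi)
  have hsub : ∀ i : Fin (Nat.find hex), IsTree
      ((t.1.preimage (List.cons (i : ℕ)) (List.cons_injective.injOn) : Finset Vertex) :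
        Set Vertex) := by
    intro i
    refine ⟨?_, ?_, ?_⟩
    · simpa using (hlt i).2 i.2
    · intro u v h
      simp only [Finset.coe_preimage, Set.mem_preimage] at h ⊢
      exact t.2.2.1 (i :: u) v h
    · intro u a b h hab
      simp only [Finset.coe_preimage, Set.mem_preimage] at h ⊢
      exact t.2.2.2 (i :: u) a b h hab
  refine ⟨⟨Nat.find hex, fun i => ⟨_, hsub i⟩⟩, ?_⟩
  ext v
  rcases v with _ | ⟨a, u⟩
  · simp [nil_mem]
  · rw [cons_mem_graft]
    simp only [Finset.mem_preimage]
    constructor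
    · rintro ⟨_, h⟩
      exact h
    · intro h
      exact ⟨(hlt a).1 (t.2.2.1 [a] u h), h⟩

/-- A finite tree is determined by the sequence of subtrees at the children of the root. -/
noncomputable def graftEquiv : (Σ d : ℕ, Fin d → FinTree) ≃ FinTree :=
  Equiv.ofBijective graft ⟨graft_injective, graft_surjective⟩

theorem prod_graft {M : Type*} [CommMonoid M] {d : ℕ} (s : Fin d → FinTree) (f : Vertex → M) :
    ∏ u ∈ (graft ⟨d, s⟩).1, f u = f [] * ∏ i : Fin d, ∏ u ∈ (s i).1, f (i :: u) := by
  change ∏ u ∈ insert [] (Finset.univ.biUnion fun i : Fin d =>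
    (s i).1.image (List.cons (i : ℕ))), f u = _
  rw [Finset.prod_insert (by simp), Finset.prod_biUnion]
  · congr 1
    refine Finset.prod_congr rfl fun i _ => ?_
    rw [Finset.prod_image (List.cons_injective.injOn)]
  · intro i _ j _ hij
    rw [Function.onFun, Finset.disjoint_left]
    rintro v hv hv'
    obtain ⟨u, -, rfl⟩ := Finset.mem_image.1 hv
    obtain ⟨u', -, h⟩ := Finset.mem_image.1 hv'
    exact hij (Fin.ext (List.cons.inj h).1.symm)

theorem sum_graft {M : Type*} [AddCommMonoid M] {d : ℕ} (s : Fin d → FinTree) (f : Vertex → M) :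
    ∑ u ∈ (graft ⟨d, s⟩).1, f u = f [] + ∑ i : Fin d, ∑ u ∈ (s i).1, f (i :: u) :=
  prod_graft (M := Multiplicative M) s f

/-- The number of vertices. -/
def size (t : FinTree) : ℕ := t.1.card

theorem size_graft {d : ℕ} (s : Fin d → FinTree) :
    size (graft ⟨d, s⟩) = (∑ i, size (s i)) + 1 := by
  simp only [size, Finset.card_eq_sum_ones]
  rw [sum_graft s fun _ => 1, add_comm]

theorem levelCount_eq_sum (t : FinTree) (k : ℕ) :
    levelCount t.1 k = ∑ u ∈ t.1, if u.length = k then 1 else 0 := by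
  rw [levelCount, ← Finset.card_filter, ← Set.ncard_coe_finset]
  simp

theorem levelCount_graft {d : ℕ} (s : Fin d → FinTree) (k : ℕ) :
    levelCount (graft ⟨d, s⟩).1 (k + 1) = ∑ i, levelCount (s i).1 k := by
  simp only [levelCount_eq_sum, sum_graft s fun u => if u.length = k + 1 then 1 else 0]
  simp

/-- The Galton–Watson weight of a finite tree. -/
noncomputable def weight (ξ : ℕ → ℝ≥0∞) (t : FinTree) : ℝ≥0∞ :=
  ∏ u ∈ t.1, ξ (childCount t.1 u)

theorem childCount_graft_nil {d : ℕ} (s : Fin d → FinTree) :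
    childCount (graft ⟨d, s⟩).1 [] = d := by
  have : children (graft ⟨d, s⟩).1 [] = Set.Iio d := by
    ext i
    simp only [children, List.nil_append, Set.mem_ofPred_eq, Finset.mem_coe, cons_mem_graft,
      Set.mem_Iio, nil_mem, exists_prop, and_true]
  rw [childCount, this, ← Finset.coe_Iio, Set.ncard_coe_finset, Nat.card_Iio]

theorem childCount_graft_cons {d : ℕ} (s : Fin d → FinTree) (i : Fin d) (u : Vertex) :
    childCount (graft ⟨d, s⟩).1 (i :: u) = childCount (s i).1 u := by
  have : children (graft ⟨d, s⟩).1 (i :: u) = children (s i).1 u := by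
    ext j
    simp [children, cons_mem_graft]
  rw [childCount, this, childCount]

theorem weight_graft (ξ : ℕ → ℝ≥0∞) {d : ℕ} (s : Fin d → FinTree) :
    weight ξ (graft ⟨d, s⟩) = ξ d * ∏ i, weight ξ (s i) := by
  rw [weight, prod_graft, childCount_graft_nil]
  simp only [childCount_graft_cons, weight]

theorem genFun_eq_genFun_graft (f : FinTree → ℝ≥0∞) :
    genFun f size = genFun (fun p => f (graft p)) fun p => size (graft p) :=
  (genFun_equiv graftEquiv f size).symm

theorem coeff_genFun (f : FinTree → ℝ≥0∞) (n : ℕ) :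
    PowerSeries.coeff n (genFun f size) =
      ∑' d, PowerSeries.coeff n (PowerSeries.X *
        genFun (fun s : Fin d → FinTree => f (graft ⟨d, s⟩)) fun s => ∑ i, size (s i)) := by
  rw [genFun_eq_genFun_graft, coeff_genFun_sigma]
  simp only [size_graft, genFun_add_one]

theorem solvesTreeEquation (ξ : ℕ → ℝ≥0∞) : SolvesTreeEquation ξ (genFun (weight ξ) size) := by
  constructor
  · rw [coeff_genFun]
    simp
  · intro n
    rw [coeff_genFun]
    simp only [weight_graft, genFun_const_mul, genFun_pi size fun _ => weight ξ]
    simp [PowerSeries.coeff_succ_X_mul]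

/-- The restriction of a finite tree to the vertices of height at most `k`. -/
def restrict (k : ℕ) (t : FinTree) : FinTree :=
  ⟨t.1.filter fun u => u.length ≤ k, by
    refine ⟨?_, ?_, ?_⟩
    · simp [nil_mem]
    · intro u v h
      simp only [Finset.coe_filter, Set.mem_ofPred_eq, List.length_append] at h ⊢
      exact ⟨t.2.2.1 u v h.1, by omega⟩
    · intro u i j h hj
      simp only [Finset.coe_filter, Set.mem_ofPred_eq, List.length_append] at h ⊢
      exact ⟨t.2.2.2 u i j h.1 hj, h.2⟩⟩

theorem coe_restrict (k : ℕ) (t : FinTree) :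
    ((restrict k t).1 : Set Vertex) = trunc t.1 k := by
  simp [restrict, trunc]

theorem coe_injective :
    Function.Injective fun t : FinTree => (t.1 : Set Vertex) :=
  Finset.coe_injective.comp Subtype.val_injective

theorem trunc_eq_iff (k : ℕ) (t t₀ : FinTree) :
    trunc t.1 k = t₀.1 ↔ restrict k t = t₀ := by
  rw [← coe_restrict]
  exact coe_injective.eq_iff

theorem restrict_graft (k : ℕ) {d : ℕ} (s : Fin d → FinTree) :
    restrict (k + 1) (graft ⟨d, s⟩) = graft ⟨d, fun i => restrict k (s i)⟩ := by
  ext v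
  rcases v with _ | ⟨a, u⟩
  · simp [nil_mem]
  · rw [cons_mem_graft]
    simp [restrict, cons_mem_graft]

theorem restrict_zero_eq (t t' : FinTree) : restrict 0 t = restrict 0 t' := by
  ext v
  rcases v with _ | ⟨a, u⟩
  · simp [nil_mem]
  · simp [restrict]

open Classical in
/-- The generating function of the trees with a given restriction to the first `k` generations. -/
theorem exists_genFun_restrict_eq (ξ : ℕ → ℝ≥0∞) (k : ℕ) (t₀ : FinTree)
    (ht₀ : restrict k t₀ = t₀) :
    ∃ ds : Multiset ℕ, ds.sum + 1 = Multiset.card ds + levelCount t₀.1 k ∧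
      genFun (fun t => if restrict k t = t₀ then weight ξ t else 0) size =
        PowerSeries.C (ds.map ξ).prod *
          (PowerSeries.X ^ Multiset.card ds * genFun (weight ξ) size ^ levelCount t₀.1 k) := by
  induction k generalizing t₀ with
  | zero =>
    have hl : levelCount t₀.1 0 = 1 := by
      rw [levelCount_eq_sum, Finset.sum_eq_single []]
      · simp
      · intro u _ hu
        simp [hu]
      · intro h
        exact absurd t₀.nil_mem h
    refine ⟨0, by simp [hl], ?_⟩
    have : ∀ t, restrict 0 t = t₀ := fun t => (restrict_zero_eq t t₀).trans ht₀
    simp [this, hl]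
  | succ k ih =>
    obtain ⟨⟨d, s₀⟩, rfl⟩ := graft_surjective t₀
    rw [restrict_graft] at ht₀
    have hs₀ : ∀ i, restrict k (s₀ i) = s₀ i := by
      have := graft_injective ht₀
      simp only [Sigma.mk.injEq, heq_eq_eq, true_and] at this
      exact fun i => congrFun this i
    choose ds hds hgen using fun i => ih (s₀ i) (hs₀ i)
    refine ⟨d ::ₘ ∑ i, ds i, ?_, ?_⟩
    · have hsum := Finset.sum_congr (rfl : (Finset.univ : Finset (Fin d)) = _) fun i _ => hds i
      simp only [Finset.sum_add_distrib, Finset.sum_const, Finset.card_univ, Fintype.card_fin,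
        smul_eq_mul, mul_one] at hsum
      have hs := map_sum (Multiset.sumAddMonoidHom (M := ℕ)) ds Finset.univ
      simp only [Multiset.coe_sumAddMonoidHom] at hs
      rw [levelCount_graft, Multiset.card_cons, Multiset.sum_cons, Multiset.card_sum, hs]
      omega
    · have hweight : ∀ s : Fin d → FinTree,
          (if restrict (k + 1) (graft ⟨d, s⟩) = graft ⟨d, s₀⟩ then weight ξ (graft ⟨d, s⟩) else 0) =
            ξ d * ∏ i, if restrict k (s i) = s₀ i then weight ξ (s i) else 0 := by
        intro s
        simp only [restrict_graft, graft_injective.eq_iff, Sigma.mk.injEq, heq_eq_eq, true_and,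
          funext_iff, weight_graft, Finset.prod_ite_zero, Finset.mem_univ, forall_const,
          mul_ite, mul_zero]
      have hother : ∀ d', d' ≠ d → ∀ s : Fin d' → FinTree,
          restrict (k + 1) (graft ⟨d', s⟩) ≠ graft ⟨d, s₀⟩ := by
        intro d' hd' s hs
        rw [restrict_graft, graft_injective.eq_iff] at hs
        exact hd' (congrArg Sigma.fst hs)
      have hmap := map_sum (Multiset.mapAddMonoidHom ξ) ds Finset.univ
      simp only [Multiset.mapAddMonoidHom_apply] at hmap
      ext n
      rw [coeff_genFun, tsum_eq_single d]
      · simp only [hweight]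
        rw [genFun_const_mul, genFun_pi size fun i t =>
          if restrict k t = s₀ i then weight ξ t else 0]
        simp only [hgen]
        rw [Finset.prod_mul_distrib, Finset.prod_mul_distrib, Finset.prod_pow_eq_pow_sum,
          Finset.prod_pow_eq_pow_sum, ← map_prod, Multiset.card_cons, Multiset.map_cons,
          Multiset.prod_cons, Multiset.card_sum, levelCount_graft, hmap, Multiset.prod_sum,
          pow_succ, (PowerSeries.C (R := ℝ≥0∞)).map_mul]
        refine congrArg _ ?_
        ring
      · intro d' hd'
        simp only [if_neg (hother d' hd' _)]
        have : genFun (fun _ : Fin d' → FinTree => (0 : ℝ≥0∞)) (fun s => ∑ i, size (s i)) = 0 := by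
          ext m
          simp [genFun]
        rw [this, mul_zero, map_zero]

end FinTree

/-! ## The law of the tree -/

namespace IsGW

variable {ξ : ℕ → ℝ≥0∞} {μ : Measure (Set Vertex)}

theorem measure_singleton (h : IsGW ξ μ) (t : FinTree) :
    μ {(t.1 : Set Vertex)} = FinTree.weight ξ t := by
  rw [h.2.2 _ t.2 t.1.finite_toSet, Finset.finite_toSet_toFinset, FinTree.weight]

open Classical in
theorem measure_inter_range (h : IsGW ξ μ) (S : Set (Set Vertex)) :
    μ (S ∩ Set.range fun t : FinTree => (t.1 : Set Vertex)) =
      ∑' t : FinTree, if (t.1 : Set Vertex) ∈ S then FinTree.weight ξ t else 0 := by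
  have hS : S ∩ (Set.range fun t : FinTree => (t.1 : Set Vertex)) =
      ⋃ t : FinTree, S ∩ {(t.1 : Set Vertex)} := by
    rw [← Set.inter_iUnion, Set.iUnion_singleton_eq_range]
  rw [hS, measure_iUnion]
  · refine tsum_congr fun t => ?_
    split_ifs with ht
    · rw [Set.inter_eq_right.2 (Set.singleton_subset_iff.2 ht), h.measure_singleton]
    · rw [Set.inter_singleton_eq_empty.2 ht, measure_empty]
  · intro t t' hne
    exact (Set.disjoint_singleton.2 fun heq => hne (FinTree.coe_injective heq)).mono
      Set.inter_subset_right Set.inter_subset_right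
  · exact fun _ => MeasurableSpace.measurableSet_top

theorem measure_range (h : IsGW ξ μ) (hξ : IsCritical ξ) :
    μ (Set.range fun t : FinTree => (t.1 : Set Vertex)) = 1 := by
  have := h.1
  have key := h.measure_inter_range Set.univ
  simp only [Set.univ_inter, Set.mem_univ, if_true] at key
  rw [← evalAt_one_genFun (FinTree.weight ξ) FinTree.size] at key
  rw [key]
  exact hξ.evalAt_one_eq_one (FinTree.solvesTreeEquation ξ) (key ▸ prob_le_one)

open Classical in
theorem measure_eq_tsum (h : IsGW ξ μ) (hξ : IsCritical ξ) (S : Set (Set Vertex)) :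
    μ S = ∑' t : FinTree, if (t.1 : Set Vertex) ∈ S then FinTree.weight ξ t else 0 := by
  have := h.1
  rw [← h.measure_inter_range]
  refine le_antisymm ?_ (measure_mono Set.inter_subset_left)
  have hc : μ (Set.range fun t : FinTree => (t.1 : Set Vertex))ᶜ = 0 :=
    (prob_compl_eq_zero_iff MeasurableSpace.measurableSet_top).2 (h.measure_range hξ)
  calc μ S ≤ μ (S ∩ Set.range fun t : FinTree => (t.1 : Set Vertex)) +
        μ (S \ Set.range fun t : FinTree => (t.1 : Set Vertex)) := measure_le_inter_add_sdiff _ _ _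
    _ ≤ _ + 0 := by
        gcongr
        exact (measure_mono fun t ht => ht.2).trans hc.le
    _ = _ := add_zero _

theorem measure_encard_eq (h : IsGW ξ μ) (hξ : IsCritical ξ) (n : ℕ) :
    μ {t | t.encard = (n : ℕ∞)} =
      PowerSeries.coeff n (genFun (FinTree.weight ξ) FinTree.size) := by
  rw [h.measure_eq_tsum hξ, genFun, PowerSeries.coeff_mk]
  refine tsum_congr fun t => ?_
  simp only [Set.mem_ofPred_eq, Set.encard_coe_eq_coe_finsetCard, Nat.cast_inj, FinTree.size]
  congr

open Classical in
theorem measure_trunc_eq (h : IsGW ξ μ) (hξ : IsCritical ξ) (k : ℕ) (t₀ : FinTree) :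
    μ {t | trunc t k = t₀.1} = evalAt 1
      (genFun (fun t => if FinTree.restrict k t = t₀ then FinTree.weight ξ t else 0)
        FinTree.size) := by
  rw [h.measure_eq_tsum hξ, evalAt_one_genFun]
  simp only [Set.mem_ofPred_eq, FinTree.trunc_eq_iff]

open Classical in
theorem measure_trunc_eq_inter (h : IsGW ξ μ) (hξ : IsCritical ξ) (k : ℕ) (t₀ : FinTree) (n : ℕ) :
    μ ({t | trunc t k = t₀.1} ∩ {t | t.encard = (n : ℕ∞)}) = PowerSeries.coeff n
      (genFun (fun t => if FinTree.restrict k t = t₀ then FinTree.weight ξ t else 0)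
        FinTree.size) := by
  rw [h.measure_eq_tsum hξ, genFun, PowerSeries.coeff_mk]
  refine tsum_congr fun t => ?_
  simp only [Set.mem_inter_iff, Set.mem_ofPred_eq, FinTree.trunc_eq_iff,
    Set.encard_coe_eq_coe_finsetCard, Nat.cast_inj, FinTree.size, and_comm (b := _ = n), ite_and]
  congr

end IsGW

/-- local limit theorem for conditioned Galton–Watson trees.  Let `ξ`
be a critical offspring distribution with `ξ(1) < 1` and let `μ` be the law of a
`ξ`-Galton–Watson tree `T`.  Then for every `k ≥ 1` and every finite tree `t₀` of height
at most `k`, along `n` with `P(#T = n) > 0`,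
`P(T^[k] = t₀ | #T = n) → (#_k t₀) ⬝ P(T^[k] = t₀)`. -/
theorem gw_local_limit (ξ : ℕ → ℝ≥0∞) (hξsum : ∑' i, ξ i = 1)
    (hξmean : ∑' i : ℕ, (i : ℝ≥0∞) * ξ i = 1) (hξ1 : ξ 1 < 1)
    (μ : Measure (Set Vertex)) (hμ : IsGW ξ μ)
    (k : ℕ) (hk : 1 ≤ k)
    (t0 : Set Vertex) (ht0 : IsTree t0) (ht0f : t0.Finite)
    (ht0h : ∀ u ∈ t0, u.length ≤ k) :
    Tendsto
      (fun n : ℕ =>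
        μ ({t | trunc t k = t0} ∩ {t | t.encard = (n : ℕ∞)})
          / μ {t | t.encard = (n : ℕ∞)})
      (atTop ⊓ 𝓟 {n : ℕ | 0 < μ {t | t.encard = (n : ℕ∞)}})
      (𝓝 ((levelCount t0 k : ℝ≥0∞) * μ {t | trunc t k = t0})) := by
  classical
  have hξ : IsCritical ξ := ⟨hξsum, hξmean, hξ1⟩
  obtain ⟨t₀, rfl⟩ : ∃ t₀ : FinTree, (t₀.1 : Set Vertex) = t0 :=
    ⟨⟨ht0f.toFinset, by rwa [ht0f.coe_toFinset]⟩, ht0f.coe_toFinset⟩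
  have hrestrict : FinTree.restrict k t₀ = t₀ := by
    rw [← FinTree.trunc_eq_iff, trunc]
    exact Set.sep_eq_self_iff_mem_true.2 ht0h
  obtain ⟨ds, hcard, hgen⟩ := FinTree.exists_genFun_restrict_eq ξ k t₀ hrestrict
  have hA := FinTree.solvesTreeEquation ξ
  have hone : evalAt 1 (genFun (FinTree.weight ξ) FinTree.size) = 1 := by
    rw [evalAt_one_genFun]
    simpa [hμ.measure_range hξ] using (hμ.measure_inter_range Set.univ).symm
  have htrunc : μ {t | trunc t k = t₀.1} = (ds.map ξ).prod := by
    rw [hμ.measure_trunc_eq hξ, hgen, evalAt_mul, evalAt_mul, evalAt_pow, evalAt_pow, evalAt_C,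
      evalAt_X, hone]
    simp
  simp only [hμ.measure_trunc_eq_inter hξ, hμ.measure_encard_eq hξ, htrunc, hgen,
    PowerSeries.coeff_C_mul, mul_div_assoc]
  rw [mul_comm (levelCount _ _ : ℝ≥0∞)]
  by_cases hprod : (ds.map ξ).prod = 0
  · simpa [hprod] using tendsto_const_nhds
  · have := hμ.1
    refine ENNReal.Tendsto.const_mul (hξ.tendsto_coeff_div_coeff hA ds ?_ _ hcard)
      (Or.inr (htrunc ▸ measure_ne_top μ _))
    exact fun d hd h0 => hprod (Multiset.prod_eq_zero (h0 ▸ Multiset.mem_map_of_mem ξ hd))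

end AvoidPaper
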